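/- arXiv:1605.08989 — 2 statements merged into one kernel-verified Lean document; each statement's English description precedes it below -/
import Mathlib

section
/- Let (X, r_X, μ_X) and (Y, r_Y, μ_Y) be probability mm spaces. Then (X, r_X, μ_X) ≼_metric (Y, r_Y, μ_Y) if and only if for every m ≥ 2 and every increasing Borel set A ⊆ ℝ^{m(m−1)/2} one has ν^{m,(X,r_X,μ_X)}(A) ≤ ν^{m,(Y,r_Y,μ_Y)}(A). -/
open MeasureTheory Metric Filter Topology

namespace MMOrder

/-- The support of a Borel measure on a metric space: the set of points all of whose
open balls have positive mass. -/
def msupp {X : Type*} [MeasurableSpace X] [MetricSpace X] (μ : Measure X) : Set X :=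
  {x : X | ∀ ε : ℝ, 0 < ε → 0 < μ (Metric.ball x ε)}

/-- `τ` is a measure-preserving sub-isometry from `(Y, r_Y, μY)` to `(X, r_X, μX)`:
it maps `supp μY` into `supp μX`, pushes `μY` forward to `μX`, and is `1`-Lipschitz
on the support of `μY`. -/
def IsMPSubIsom {X Y : Type*} [MeasurableSpace X] [MetricSpace X]
    [MeasurableSpace Y] [MetricSpace Y] (μX : Measure X) (μY : Measure Y) (τ : Y → X) : Prop :=
  Measurable τ ∧ Set.MapsTo τ (msupp μY) (msupp μX) ∧ μY.map τ = μX ∧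
    ∀ y₁ ∈ msupp μY, ∀ y₂ ∈ msupp μY, dist (τ y₁) (τ y₂) ≤ dist y₁ y₂

/-- `(X, r_X, μX) ≼_metric (Y, r_Y, μY)`: there is a measure-preserving sub-isometry
from `(Y, r_Y, μY)` to `(X, r_X, μX)`. -/
def LeMetric {X Y : Type*} [MeasurableSpace X] [MetricSpace X]
    [MeasurableSpace Y] [MetricSpace Y] (μX : Measure X) (μY : Measure Y) : Prop :=
  ∃ τ : Y → X, IsMPSubIsom μX μY τ

/-- `(X, r_X, μX) ≼ (Y, r_Y, μY)`: there is a Borel measure `μY' ≤ μY` on `Y` and a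
measure-preserving sub-isometry from `(Y, r_Y, μY')` to `(X, r_X, μX)`. -/
def LeGen {X Y : Type*} [MeasurableSpace X] [MetricSpace X]
    [MeasurableSpace Y] [MetricSpace Y] (μX : Measure X) (μY : Measure Y) : Prop :=
  ∃ μY' : Measure Y, μY' ≤ μY ∧ LeMetric μX μY'

/-- `(X, r_X, μX) ≼_measure (Y, r_Y, μY)`: there is an isometry `τ` on `supp μY`
with `μX ≤ μY ∘ τ⁻¹`. -/
def LeMeasure {X Y : Type*} [MeasurableSpace X] [MetricSpace X]
    [MeasurableSpace Y] [MetricSpace Y] (μX : Measure X) (μY : Measure Y) : Prop :=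
  ∃ τ : Y → X, Measurable τ ∧
    (∀ y₁ ∈ msupp μY, ∀ y₂ ∈ msupp μY, dist (τ y₁) (τ y₂) = dist y₁ y₂) ∧
    μX ≤ μY.map τ

/-- Two mm spaces are equivalent: there is a measurable map `φ : X → Y` pushing `μX`
forward to `μY` which restricts to an isometry on `supp μX` (onto its image). -/
def MMEquiv {X Y : Type*} [MeasurableSpace X] [MetricSpace X]
    [MeasurableSpace Y] [MetricSpace Y] (μX : Measure X) (μY : Measure Y) : Prop :=
  ∃ φ : X → Y, Measurable φ ∧ μX.map φ = μY ∧
    ∀ x₁ ∈ msupp μX, ∀ x₂ ∈ msupp μX, dist (φ x₁) (φ x₂) = dist x₁ x₂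

/-- Index set for the entries of a distance matrix of order `m`:
pairs `(i, j)` with `i < j`; it has `m(m-1)/2` elements, so `DIdx m → ℝ` is
`ℝ^{m(m-1)/2}` with its coordinatewise partial order. -/
def DIdx (m : ℕ) : Type := {p : Fin m × Fin m // p.1 < p.2}

instance (m : ℕ) : MeasurableSpace (DIdx m → ℝ) := by unfold DIdx; infer_instance
instance (m : ℕ) : PartialOrder (DIdx m → ℝ) := by unfold DIdx; infer_instance

/-- The distance matrix map of order `m`. -/
def distMatMap {X : Type*} [MetricSpace X] (m : ℕ) (x : Fin m → X) : DIdx m → ℝ :=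
  fun p => dist (x p.val.1) (x p.val.2)

/-- The distance matrix measure of order `m`: the pushforward of `μ^{⊗ m}` under the
distance matrix map. -/
noncomputable def nuM {X : Type*} [MeasurableSpace X] [MetricSpace X]
    (μ : Measure X) (m : ℕ) : Measure (DIdx m → ℝ) :=
  (Measure.pi fun _ : Fin m => μ).map (distMatMap m)

/-- The distance matrix measure of order `2`, viewed as a measure on `ℝ`
(the law of the distance of two independently sampled points). -/
noncomputable def nu2 {X : Type*} [MeasurableSpace X] [MetricSpace X]
    (μ : Measure X) : Measure ℝ :=
  (μ.prod μ).map fun p : X × X => dist p.1 p.2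

/-- `∫ (1 - e^{-λ r}) ν^{2,(X,r,μ)}(dr)`. -/
noncomputable def nu2Int {X : Type*} [MeasurableSpace X] [MetricSpace X]
    (l : ℝ) (μ : Measure X) : ℝ :=
  ∫ r, (1 - Real.exp (-l * r)) ∂(nu2 μ)

/-- A metric measure space: a complete separable metric space together with a finite
Borel measure. -/
structure MM : Type 1 where
  carrier : Type
  ms : MeasurableSpace carrier
  met : MetricSpace carrier
  sep : SecondCountableTopology carrier
  cmp : CompleteSpace carrier
  bor : BorelSpace carrier
  μ : Measure carrier
  fin : IsFiniteMeasure μ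

attribute [instance] MM.ms MM.met MM.sep MM.cmp MM.bor MM.fin

/-- Gromov-weak convergence of a sequence of mm spaces: convergence of total masses and
of all integrals of bounded continuous test functions against the distance matrix
measures of every order `m ≥ 2`. -/
def GromovWeakTendsto (Z : ℕ → MM) (W : MM) : Prop :=
  Tendsto (fun n => (Z n).μ Set.univ) atTop (nhds (W.μ Set.univ)) ∧
  ∀ m : ℕ, 2 ≤ m → ∀ φ : (DIdx m → ℝ) → ℝ, Continuous φ → (∃ C : ℝ, ∀ v, |φ v| ≤ C) →
    Tendsto (fun n => ∫ v, φ v ∂(nuM (Z n).μ m)) atTop (nhds (∫ v, φ v ∂(nuM W.μ m)))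

/-- `Q` is a coupling of `μX` and `μY`. -/
def IsCoupling {X Y : Type*} [MeasurableSpace X] [MeasurableSpace Y]
    (μX : Measure X) (μY : Measure Y) (Q : Measure (X × Y)) : Prop :=
  Q.map Prod.fst = μX ∧ Q.map Prod.snd = μY

/-- The Eurandom cost `∬ |e^{-λ r_Y(y,y')} - e^{-λ r_X(x,x')}| Q(d(x,y)) Q(d(x',y'))`
of a coupling `Q`. -/
noncomputable def eurCost {X Y : Type*} [MeasurableSpace X] [MetricSpace X]
    [MeasurableSpace Y] [MetricSpace Y] (l : ℝ) (Q : Measure (X × Y)) : ℝ :=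
  ∫ p, |Real.exp (-l * dist p.1.2 p.2.2) - Real.exp (-l * dist p.1.1 p.2.1)| ∂(Q.prod Q)

/-- The Eurandom distance `dEur^λ`: the infimum of the Eurandom cost over all couplings. -/
noncomputable def dEur {X Y : Type*} [MeasurableSpace X] [MetricSpace X]
    [MeasurableSpace Y] [MetricSpace Y] (l : ℝ) (μX : Measure X) (μY : Measure Y) : ℝ :=
  sInf {c : ℝ | ∃ Q : Measure (X × Y), IsCoupling μX μY Q ∧ c = eurCost l Q}

/-- The generalized Eurandom distance `dgEur^λ`. -/
noncomputable def dgEur {X Y : Type*} [MeasurableSpace X] [MetricSpace X]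
    [MeasurableSpace Y] [MetricSpace Y] (l : ℝ) (μX : Measure X) (μY : Measure Y) : ℝ :=
  sInf {c : ℝ | ∃ (μX' : Measure X) (μY' : Measure Y), μX' ≤ μX ∧ μY' ≤ μY ∧
    μX' Set.univ = μY' Set.univ ∧
    c = ((nu2Int l μX - nu2Int l μX') + (nu2Int l μY - nu2Int l μY')) + dEur l μX' μY'}

/-- The metric `c · r` obtained by scaling a metric by a positive constant. -/
noncomputable def scaleMetric {X : Type*} (c : ℝ) (hc : 0 < c) (m : MetricSpace X) :
    MetricSpace X where
  dist x y := c * m.dist x y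
  dist_self x := by simp [m.dist_self]
  dist_comm x y := by simp [m.dist_comm x y]
  dist_triangle x y z := by
    show c * m.dist x z ≤ c * m.dist x y + c * m.dist y z
    have h := mul_le_mul_of_nonneg_left (m.dist_triangle x y z) hc.le
    linarith
  eq_of_dist_eq_zero := by
    intro x y h
    have h' : c * m.dist x y = 0 := h
    exact m.eq_of_dist_eq_zero (by
      rcases mul_eq_zero.1 h' with h'' | h''
      · exact absurd h'' hc.ne'
      · exact h'')

/-- The `ℓ¹`-sum metric `r_X ⊕ r_Z` on a product space. -/
noncomputable def sumMetric {X Z : Type*} (mX : MetricSpace X) (mZ : MetricSpace Z) :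
    MetricSpace (X × Z) where
  dist p q := mX.dist p.1 q.1 + mZ.dist p.2 q.2
  dist_self p := by simp [mX.dist_self, mZ.dist_self]
  dist_comm p q := by simp [mX.dist_comm p.1 q.1, mZ.dist_comm p.2 q.2]
  dist_triangle p q s := by
    show mX.dist p.1 s.1 + mZ.dist p.2 s.2 ≤
      (mX.dist p.1 q.1 + mZ.dist p.2 q.2) + (mX.dist q.1 s.1 + mZ.dist q.2 s.2)
    have h1 := mX.dist_triangle p.1 q.1 s.1
    have h2 := mZ.dist_triangle p.2 q.2 s.2
    linarith
  eq_of_dist_eq_zero := by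
    intro p q h
    have h' : mX.dist p.1 q.1 + mZ.dist p.2 q.2 = 0 := h
    have n1 := @dist_nonneg _ mX.toPseudoMetricSpace p.1 q.1
    have n2 := @dist_nonneg _ mZ.toPseudoMetricSpace p.2 q.2
    exact Prod.ext (mX.eq_of_dist_eq_zero (by linarith)) (mZ.eq_of_dist_eq_zero (by linarith))

/-- The modulus of mass distribution `v_δ`. -/
noncomputable def vDelta {X : Type*} [MeasurableSpace X] [MetricSpace X]
    (μ : Measure X) (δ : ℝ) : ℝ :=
  sInf {ε : ℝ | 0 < ε ∧ μ {x : X | μ (Metric.ball x ε) ≤ ENNReal.ofReal δ} < ENNReal.ofReal ε}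

/-- `P` is the countable product `μ^{⊗ ℕ}` of the probability measure `μ`, characterized
by its values on measurable cylinder sets. -/
def IsInfiniteProduct {X : Type*} [MeasurableSpace X] (μ : Measure X)
    (P : Measure (ℕ → X)) : Prop :=
  IsProbabilityMeasure P ∧ ∀ (s : Finset ℕ) (A : ℕ → Set X), (∀ i, MeasurableSet (A i)) →
    P {f : ℕ → X | ∀ i ∈ s, f i ∈ A i} = ∏ i ∈ s, μ (A i)

/-- Index set for the entries of the infinite distance matrix: pairs `(i, j)` of
naturals with `i < j`. -/
def NIdx : Type := {p : ℕ × ℕ // p.1 < p.2}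

instance : MeasurableSpace (NIdx → ℝ) := by unfold NIdx; infer_instance
instance : PartialOrder (NIdx → ℝ) := by unfold NIdx; infer_instance

/-- The infinite distance matrix map. -/
def distMatMapInf {X : Type*} [MetricSpace X] (x : ℕ → X) : NIdx → ℝ :=
  fun p => dist (x p.val.1) (x p.val.2)

/-- The simple graph on `Fin n` determined by a family of edge indicators indexed by
the pairs `i < j`. -/
def graphOf {n : ℕ} (b : DIdx n → Bool) : SimpleGraph (Fin n) :=
  SimpleGraph.fromRel fun i j => ∃ e : DIdx n, (e.val = (i, j) ∨ e.val = (j, i)) ∧ b e = true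

/-- Graph distance with the convention that points in different connected components
are at distance `n`. -/
noncomputable def graphDist {n : ℕ} (g : SimpleGraph (Fin n)) (i j : Fin n) : ℝ :=
  @ite ℝ (g.Reachable i j) (Classical.dec _) (g.dist i j : ℝ) (n : ℝ)

noncomputable def freq {X : Type*} (x : ℕ → X) (n : ℕ) (W : Set X) : ℝ :=
  (∑ i ∈ Finset.range n, W.indicator (fun _ => (1 : ℝ)) (x i)) / n

def Good {X : Type*} [MeasurableSpace X] [TopologicalSpace X] (μ : Measure X) (x : ℕ → X) : Prop :=
  ∀ W : Set X, IsOpen W → ∀ c : ℝ, c < μ.real W → ∀ᶠ n in atTop, c < freq x n W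

lemma freq_mono {X Y : Type*} (x : ℕ → X) (y : ℕ → Y) (n : ℕ) {V : Set X} {W : Set Y}
    (h : ∀ i, y i ∈ W → x i ∈ V) : freq y n W ≤ freq x n V := by
  classical
  unfold freq
  gcongr with i _
  by_cases hi : y i ∈ W
  · simp [hi, h i hi]
  · simp only [Set.indicator_of_notMem hi]
    exact Set.indicator_nonneg (fun _ _ => zero_le_one) _

lemma freq_compl {X : Type*} (x : ℕ → X) {n : ℕ} (hn : 0 < n) (V : Set X) :
    freq x n V + freq x n Vᶜ = 1 := by
  classical
  unfold freq
  rw [← add_div, ← Finset.sum_add_distrib]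
  have : ∀ i, V.indicator (fun _ => (1 : ℝ)) (x i) + Vᶜ.indicator (fun _ => (1 : ℝ)) (x i) = 1 := by
    intro i
    by_cases hi : x i ∈ V <;> simp [hi]
  simp only [this]
  have : (n : ℝ) ≠ 0 := by positivity
  simp [this]

/-- strong law for a measurable set -/
lemma ae_freq {X : Type*} [MeasurableSpace X] (μ : Measure X) [IsProbabilityMeasure μ]
    {U : Set X} (hU : MeasurableSet U) :
    ∀ᵐ x ∂(Measure.infinitePi fun _ : ℕ => μ),
      Tendsto (fun n => freq x n U) atTop (𝓝 (μ.real U)) := by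
  have hm : Measurable (U.indicator (fun _ => (1 : ℝ))) := measurable_const.indicator hU
  have hi : ProbabilityTheory.iIndepFun (fun (i : ℕ) (x : ℕ → X) =>
      U.indicator (fun _ => (1 : ℝ)) (x i)) (Measure.infinitePi fun _ : ℕ => μ) :=
    ProbabilityTheory.iIndepFun_infinitePi (fun _ => hm)
  have hid : ∀ i : ℕ, ProbabilityTheory.IdentDistrib (fun (x : ℕ → X) =>
      U.indicator (fun _ => (1 : ℝ)) (x i)) (fun (x : ℕ → X) =>
      U.indicator (fun _ => (1 : ℝ)) (x 0)) (Measure.infinitePi fun _ : ℕ => μ)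
      (Measure.infinitePi fun _ : ℕ => μ) := by
    intro i
    refine ⟨(hm.comp (measurable_pi_apply i)).aemeasurable,
      (hm.comp (measurable_pi_apply 0)).aemeasurable, ?_⟩
    have key : ∀ j : ℕ, (Measure.infinitePi fun _ : ℕ => μ).map (fun x =>
      U.indicator (fun _ => (1 : ℝ)) (x j)) = μ.map (U.indicator (fun _ => (1 : ℝ))) := by
      intro j
      conv_rhs => rw [← (measurePreserving_eval_infinitePi (fun _ : ℕ => μ) j).map_eq]
      rw [Measure.map_map hm (measurable_pi_apply j)]
      rfl
    rw [key, key]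
  have hint : Integrable (fun (x : ℕ → X) =>
      U.indicator (fun _ => (1 : ℝ)) (x 0)) (Measure.infinitePi fun _ : ℕ => μ) := by
    refine Integrable.of_bound (C := 1) (hm.comp (measurable_pi_apply 0)).aestronglyMeasurable ?_
    refine Eventually.of_forall fun x => ?_
    by_cases h : x 0 ∈ U <;> simp [h]
  have := ProbabilityTheory.strong_law_ae_real _ hint (fun i j hij => hi.indepFun hij) hid
  have hE : ∫ (x : ℕ → X), U.indicator (fun _ => (1 : ℝ)) (x 0) ∂(Measure.infinitePi fun _ : ℕ => μ)
      = μ.real U := by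
    rw [show μ.real U = ∫ z, U.indicator (fun _ => (1 : ℝ)) z ∂μ by
      rw [integral_indicator hU]; simp]
    conv_rhs => rw [← (measurePreserving_eval_infinitePi (fun _ : ℕ => μ) 0).map_eq]
    rw [integral_map (measurable_pi_apply 0).aemeasurable hm.aestronglyMeasurable]
  rw [hE] at this
  exact this

lemma ae_good {X : Type*} [MeasurableSpace X] [TopologicalSpace X] [SecondCountableTopology X]
    [BorelSpace X] (μ : Measure X) [IsProbabilityMeasure μ] :
    ∀ᵐ x ∂(Measure.infinitePi fun _ : ℕ => μ), Good μ x := by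
  classical
  set B := TopologicalSpace.countableBasis X with hB
  have hBc : B.Countable := TopologicalSpace.countable_countableBasis X
  have hBb : TopologicalSpace.IsTopologicalBasis B := TopologicalSpace.isBasis_countableBasis X
  have : Countable B := hBc.to_subtype
  have h1 : ∀ᵐ x ∂(Measure.infinitePi fun _ : ℕ => μ), ∀ F : Finset B,
      Tendsto (fun n => freq x n (⋃ u ∈ F, (u : Set X))) atTop
        (𝓝 (μ.real (⋃ u ∈ F, (u : Set X)))) := by
    rw [ae_all_iff]
    intro F
    apply ae_freq
    exact (isOpen_biUnion fun u _ => hBb.isOpen u.2).measurableSet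
  filter_upwards [h1] with x hx W hW c hc
  -- finite subfamily
  obtain ⟨F, hFW, hF⟩ : ∃ F : Finset B, (⋃ u ∈ F, (u : Set X)) ⊆ W ∧
      c < μ.real (⋃ u ∈ F, (u : Set X)) := by
    let T : Finset B → Set X := fun F => ⋃ u : B, ⋃ _ : u ∈ F.filter (fun u : B => (u : Set X) ⊆ W), (u : Set X)
    have hT : W = ⋃ F, T F := by
      apply Set.Subset.antisymm
      · intro w hw
        obtain ⟨u, hu, hwu, huW⟩ := hBb.exists_subset_of_mem_open hw hW
        refine Set.mem_iUnion.2 ⟨{⟨u, hu⟩}, ?_⟩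
        simp only [T, Set.mem_iUnion]
        exact ⟨⟨u, hu⟩, by simp [huW], hwu⟩
      · refine Set.iUnion_subset fun F => Set.iUnion₂_subset fun u hu => ?_
        exact (Finset.mem_filter.1 hu).2
    have hmono : Monotone T := by
      intro F G hFG
      exact Set.biUnion_subset_biUnion_left (fun u hu => by
        have := Finset.filter_subset_filter (fun u : B => (u : Set X) ⊆ W) hFG
        exact this hu)
    have hlim := tendsto_measure_iUnion_atTop (μ := μ) hmono
    rw [← hT] at hlim
    have hlim' := (ENNReal.tendsto_toReal (measure_ne_top μ W)).comp hlim
    obtain ⟨F, hF⟩ := (hlim'.eventually (lt_mem_nhds hc)).exists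
    refine ⟨F.filter (fun u : B => (u : Set X) ⊆ W), ?_, hF⟩
    exact Set.iUnion₂_subset fun u hu => (Finset.mem_filter.1 hu).2
  filter_upwards [(hx F).eventually (lt_mem_nhds hF)] with n hn
  exact hn.trans_le (freq_mono x x n fun i hi => hFW hi)

lemma good_closed {X : Type*} [MeasurableSpace X] [TopologicalSpace X] [BorelSpace X]
    {μ : Measure X} [IsProbabilityMeasure μ] {x : ℕ → X} (hx : Good μ x) {K : Set X}
    (hK : IsClosed K) {c : ℝ} (hc : μ.real K < c) : ∀ᶠ n in atTop, freq x n K < c := by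
  have := hx Kᶜ hK.isOpen_compl (1 - c) (by
    rw [probReal_compl_eq_one_sub hK.measurableSet]; linarith)
  filter_upwards [this, eventually_gt_atTop 0] with n hn h0
  have := freq_compl x h0 K
  linarith

lemma good_compare {X Y : Type*} [MeasurableSpace X] [TopologicalSpace X] [BorelSpace X]
    [MeasurableSpace Y] [TopologicalSpace Y]
    {μ : Measure X} [IsProbabilityMeasure μ] {x : ℕ → X} (hx : Good μ x)
    {ν : Measure Y} {y : ℕ → Y} (hy : Good ν y) {K : Set X} (hK : IsClosed K)
    {W : Set Y} (hW : IsOpen W) (h : ∀ i, y i ∈ W → x i ∈ K) : ν.real W ≤ μ.real K := by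
  by_contra! hlt
  obtain ⟨c, h1, h2⟩ := exists_between hlt
  obtain ⟨n, hn1, hn2⟩ := ((good_closed hx hK h1).and (hy W hW c h2)).exists
  have := freq_mono x y n h
  linarith

lemma good_null {Y : Type*} [MeasurableSpace Y] [TopologicalSpace Y]
    {ν : Measure Y} [IsFiniteMeasure ν] {y : ℕ → Y} (hy : Good ν y)
    {W : Set Y} (hW : IsOpen W) (h : ∀ i, y i ∉ W) : ν W = 0 := by
  by_contra hne
  have hpos : 0 < ν.real W := ENNReal.toReal_pos hne (measure_ne_top _ _)
  obtain ⟨n, hn⟩ := (hy W hW 0 hpos).exists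
  unfold freq at hn
  simp [h] at hn

lemma exists_limit {X Y : Type*} [MetricSpace X] [CompleteSpace X] [MetricSpace Y]
    {x : ℕ → X} {y : ℕ → Y} (h : ∀ i j, dist (x i) (x j) ≤ dist (y i) (y j))
    {a : Y} (ha : a ∈ closure (Set.range y)) : ∃ z, ∀ i, dist z (x i) ≤ dist a (y i) := by
  have h1 : ∀ n : ℕ, ∃ i, dist a (y i) < 1 / ((n : ℝ) + 1) := by
    intro n
    obtain ⟨_, ⟨i, rfl⟩, hi⟩ := Metric.mem_closure_iff.1 ha (1 / ((n : ℝ) + 1)) (by positivity)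
    exact ⟨i, hi⟩
  choose u hu using h1
  have hlim : Tendsto (fun n => y (u n)) atTop (𝓝 a) := by
    rw [tendsto_iff_dist_tendsto_zero]
    refine squeeze_zero (fun _ => dist_nonneg) (fun n => ?_) tendsto_one_div_add_atTop_nhds_zero_nat
    rw [dist_comm]; exact (hu n).le
  have hc : CauchySeq (fun n => x (u n)) := by
    have := hlim.cauchySeq
    rw [Metric.cauchySeq_iff] at this ⊢
    intro ε hε
    obtain ⟨N, hN⟩ := this ε hε
    exact ⟨N, fun m hm n hn => (h _ _).trans_lt (hN m hm n hn)⟩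
  obtain ⟨z, hz⟩ := cauchySeq_tendsto_of_complete hc
  refine ⟨z, fun i => ?_⟩
  exact le_of_tendsto_of_tendsto' (hz.dist tendsto_const_nhds) (hlim.dist tendsto_const_nhds)
    (fun n => h _ _)

lemma measure_eq_of_closed_le {X : Type*} [MeasurableSpace X] [MetricSpace X] [BorelSpace X]
    (μ ν : Measure X) [IsProbabilityMeasure μ] [IsProbabilityMeasure ν]
    (h : ∀ F, IsClosed F → ν.real F ≤ μ.real F) : ν = μ := by
  have ho : ∀ U, IsOpen U → μ.real U ≤ ν.real U := by
    intro U hU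
    have := h _ hU.isClosed_compl
    rw [probReal_compl_eq_one_sub hU.measurableSet, probReal_compl_eq_one_sub hU.measurableSet]
      at this
    linarith
  have hlim : ∀ (ρ : Measure X) [IsProbabilityMeasure ρ] (F : Set X), IsClosed F →
      Tendsto (fun n : ℕ => ρ.real (Metric.thickening (1 / ((n : ℝ) + 1)) F)) atTop (𝓝 (ρ.real F)) := by
    intro ρ _ F hF
    have h0 := (tendsto_measure_thickening_of_isClosed (μ := ρ) ⟨1, one_pos, measure_ne_top _ _⟩ hF)
    have h1 : Tendsto (fun n : ℕ => 1 / ((n : ℝ) + 1)) atTop (𝓝[>] 0) :=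
      tendsto_nhdsWithin_iff.2 ⟨tendsto_one_div_add_atTop_nhds_zero_nat,
        Eventually.of_forall fun n => by simp only [Set.mem_Ioi]; positivity⟩
    exact (ENNReal.tendsto_toReal (measure_ne_top ρ F)).comp (h0.comp h1)
  have hF : ∀ F, IsClosed F → ν.real F = μ.real F := by
    intro F hF
    refine le_antisymm (h F hF) ?_
    exact le_of_tendsto_of_tendsto' (hlim μ F hF) (hlim ν F hF)
      fun n => ho _ Metric.isOpen_thickening
  refine ext_of_generate_finite {s | IsClosed s} ?_ isPiSystem_isClosed ?_ (by simp)
  · rw [BorelSpace.measurable_eq (α := X), borel_eq_generateFrom_isClosed]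
  · intro s hs
    have := hF s hs
    rwa [measureReal_def, measureReal_def, ENNReal.toReal_eq_toReal_iff' (measure_ne_top _ _) (measure_ne_top _ _)] at this

lemma measurable_distMatMap {X : Type*} [MeasurableSpace X] [MetricSpace X]
    [SecondCountableTopology X] [BorelSpace X] (m : ℕ) :
    Measurable (distMatMap m : (Fin m → X) → DIdx m → ℝ) := by
  refine @measurable_pi_lambda _ _ _ _ _ _ fun p => ?_
  exact (measurable_pi_apply _).dist (measurable_pi_apply _)

lemma nuM_apply {X : Type*} [MeasurableSpace X] [MetricSpace X]
    [SecondCountableTopology X] [BorelSpace X] (μ : Measure X) [IsProbabilityMeasure μ] (m : ℕ)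
    {A : Set (DIdx m → ℝ)} (hA : MeasurableSet A) :
    nuM μ m A = (Measure.infinitePi fun _ : ℕ => μ)
      {x | distMatMap m (fun i : Fin m => x i) ∈ A} := by
  have h := Measure.map_infinitePi_infinitePi_of_inj (P := fun _ : ℕ => μ)
    (f := fun i : Fin m => (i : ℕ)) Fin.val_injective
  rw [Measure.infinitePi_eq_pi (μ := fun _ : Fin m => μ)] at h
  rw [nuM, Measure.map_apply (measurable_distMatMap m) hA, ← h,
    Measure.map_apply (by fun_prop) (measurable_distMatMap m hA)]
  rfl

def upSet {X : Type*} [MetricSpace X] (G : Set (ℕ → X)) (m : ℕ) : Set (DIdx m → ℝ) :=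
  {v | ∃ g ∈ G, ∀ p, distMatMap m (fun i : Fin m => g i) p ≤ v p}

lemma measurableSet_upSet {X : Type*} [MetricSpace X] {G : Set (ℕ → X)} (hG : IsCompact G) (m : ℕ) :
    MeasurableSet (upSet G m) := by
  have : Finite (DIdx m) := by unfold DIdx; infer_instance
  have hcl : IsClosed (upSet G m) := by
    have hC : IsClosed
        {q : (ℕ → X) × (DIdx m → ℝ) | ∀ p, distMatMap m (fun i : Fin m => q.1 i) p ≤ q.2 p} := by
      simp only [Set.ofPred_forall]
      refine isClosed_iInter fun p => isClosed_le ?_ ?_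
      · unfold distMatMap
        fun_prop
      · fun_prop
    have himg : upSet G m = Prod.snd '' {q : G × (DIdx m → ℝ) |
        ∀ p, distMatMap m (fun i : Fin m => q.1.1 i) p ≤ q.2 p} := by
      ext v
      constructor
      · rintro ⟨g, hg, h⟩
        exact ⟨(⟨g, hg⟩, v), h, rfl⟩
      · rintro ⟨⟨g, w⟩, h, rfl⟩
        exact ⟨g.1, g.2, h⟩
    have : CompactSpace G := isCompact_iff_compactSpace.1 hG
    rw [himg]
    refine isClosedMap_snd_of_compactSpace _ ?_
    exact hC.preimage (f := fun q : G × (DIdx m → ℝ) => (q.1.1, q.2)) (by fun_prop)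
  exact @IsClosed.measurableSet _ _ _ _ (@Pi.opensMeasurableSpace _ _ _ _ _ _ _) hcl

lemma exists_pair {X Y : Type*} [MeasurableSpace X] [MetricSpace X] [SecondCountableTopology X]
    [CompleteSpace X] [BorelSpace X] [MeasurableSpace Y] [MetricSpace Y]
    [SecondCountableTopology Y] [CompleteSpace Y] [BorelSpace Y]
    (μX : Measure X) (μY : Measure Y)
    [IsProbabilityMeasure μX] [IsProbabilityMeasure μY]
    (h : ∀ m : ℕ, 2 ≤ m → ∀ A : Set (DIdx m → ℝ), MeasurableSet A →
        (∀ a ∈ A, ∀ b, a ≤ b → b ∈ A) → nuM μX m A ≤ nuM μY m A) :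
    ∃ (x : ℕ → X) (y : ℕ → Y), Good μX x ∧ Good μY y ∧
      ∀ i j, dist (x i) (x j) ≤ dist (y i) (y j) := by
  set PX := Measure.infinitePi fun _ : ℕ => μX with hPX
  set PY := Measure.infinitePi fun _ : ℕ => μY with hPY
  have hgx : {x | Good μX x} ∈ ae PX := ae_good μX
  obtain ⟨t, htG, htm, ht⟩ : ∃ t ⊆ {x | Good μX x}, MeasurableSet t ∧ PX t = 1 := by
    have h0 : PX {x | Good μX x}ᶜ = 0 := hgx
    refine ⟨(toMeasurable PX {x | Good μX x}ᶜ)ᶜ, ?_, (measurableSet_toMeasurable _ _).compl, ?_⟩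
    · rw [Set.compl_subset_comm]; exact subset_toMeasurable _ _
    · rw [prob_compl_eq_one_sub (measurableSet_toMeasurable _ _), measure_toMeasurable, h0]; simp
  obtain ⟨G, hGt, hGc, hGpos⟩ := htm.exists_lt_isCompact (μ := PX) (r := 0) (by simp [ht])
  let E : ℕ → Set (ℕ → Y) := fun m => {y | distMatMap m (fun i : Fin m => y i) ∈ upSet G m}
  have hEm : ∀ m, MeasurableSet (E m) := fun m =>
    ((measurable_distMatMap m).comp (by fun_prop :
      Measurable (fun (y : ℕ → Y) (i : Fin m) => y i))) (measurableSet_upSet hGc m)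
  have hEanti : Antitone E := by
    rintro m n hmn y ⟨g, hg, hv⟩
    refine ⟨g, hg, fun p => ?_⟩
    exact hv ⟨(Fin.castLE hmn p.1.1, Fin.castLE hmn p.1.2), p.2⟩
  have hE2 : ∀ m, 2 ≤ m → PX G ≤ PY (E m) := by
    intro m hm
    have h1 := h m hm (upSet G m) (measurableSet_upSet hGc m) (by
      rintro a ⟨g, hg, ha⟩ b hab
      exact ⟨g, hg, fun p => (ha p).trans (hab p)⟩)
    rw [nuM_apply _ _ (measurableSet_upSet hGc m), nuM_apply _ _ (measurableSet_upSet hGc m)] at h1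
    refine le_trans (measure_mono ?_) h1
    intro g hg
    exact ⟨g, hg, fun p => le_rfl⟩
  have hlim := tendsto_measure_iInter_atTop (μ := PY) (fun m => (hEm m).nullMeasurableSet) hEanti
    ⟨0, measure_ne_top _ _⟩
  have hge : PX G ≤ PY (⋂ m, E m) :=
    ge_of_tendsto hlim ((eventually_ge_atTop 2).mono hE2)
  have hpos : PY (⋂ m, E m) ≠ 0 := (hGpos.trans_le hge).ne'
  obtain ⟨y, hyE, hyG⟩ : ∃ y ∈ (⋂ m, E m), Good μY y := by
    by_contra! hcon
    refine hpos (measure_mono_null ?_ (ae_good μY))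
    exact fun y hy => hcon y hy
  let S : ℕ → Set (ℕ → X) := fun m =>
    G ∩ {g | ∀ p : DIdx m, distMatMap m (fun i : Fin m => g i) p ≤ distMatMap m (fun i : Fin m => y i) p}
  have hScl : ∀ m, IsClosed {g : ℕ → X | ∀ p : DIdx m, distMatMap m (fun i : Fin m => g i) p ≤
      distMatMap m (fun i : Fin m => y i) p} := by
    intro m
    simp only [Set.ofPred_forall]
    refine isClosed_iInter fun p => isClosed_le ?_ continuous_const
    unfold distMatMap
    fun_prop
  obtain ⟨x, hx⟩ : (⋂ m, S m).Nonempty := by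
    refine IsCompact.nonempty_iInter_of_sequence_nonempty_isCompact_isClosed S ?_ ?_ ?_ ?_
    · rintro m g ⟨hg, hv⟩
      refine ⟨hg, fun p => ?_⟩
      exact hv ⟨(Fin.castLE (Nat.le_succ m) p.1.1, Fin.castLE (Nat.le_succ m) p.1.2), p.2⟩
    · intro m
      obtain ⟨g, hg, hv⟩ := Set.mem_iInter.1 hyE m
      exact ⟨g, hg, hv⟩
    · exact hGc.inter_right (hScl 0)
    · exact fun m => hGc.isClosed.inter (hScl m)
  have hlt : ∀ i j, i < j → dist (x i) (x j) ≤ dist (y i) (y j) := by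
    intro i j hij
    have := (Set.mem_iInter.1 hx (j + 1)).2 ⟨(⟨i, by omega⟩, ⟨j, by omega⟩), hij⟩
    exact this
  refine ⟨x, y, htG (hGt (Set.mem_iInter.1 hx 0).1), hyG, fun i j => ?_⟩
  rcases lt_trichotomy i j with hij | rfl | hij
  · exact hlt i j hij
  · simp
  · rw [dist_comm, dist_comm (y i)]; exact hlt j i hij

lemma leMetric_of_pair {X Y : Type*} [MeasurableSpace X] [MetricSpace X]
    [SecondCountableTopology X]
    [CompleteSpace X] [BorelSpace X] [MeasurableSpace Y] [MetricSpace Y]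
    [SecondCountableTopology Y] [BorelSpace Y]
    (μX : Measure X) (μY : Measure Y)
    [IsProbabilityMeasure μX] [IsProbabilityMeasure μY] {x : ℕ → X} {y : ℕ → Y}
    (hx : Good μX x) (hy : Good μY y) (h : ∀ i j, dist (x i) (x j) ≤ dist (y i) (y j)) :
    LeMetric μX μY := by
  classical
  set C : Set Y := closure (Set.range y) with hC
  have hCcl : IsClosed C := isClosed_closure
  have hyC : ∀ i, y i ∈ C := fun i => subset_closure ⟨i, rfl⟩
  have hC0 : μY Cᶜ = 0 := good_null hy hCcl.isOpen_compl fun i hi => hi (hyC i)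
  have hex : ∀ a : Y, ∃ z, a ∈ C → ∀ i, dist z (x i) ≤ dist a (y i) := by
    intro a
    by_cases ha : a ∈ C
    · obtain ⟨z, hz⟩ := exists_limit h ha
      exact ⟨z, fun _ => hz⟩
    · exact ⟨x 0, fun h => absurd h ha⟩
  choose σ hσ using hex
  have hσL : ∀ a ∈ C, ∀ b ∈ C, dist (σ a) (σ b) ≤ dist a b := by
    intro a ha b hb
    refine le_of_forall_pos_le_add fun ε hε => ?_
    obtain ⟨_, ⟨i, rfl⟩, hi⟩ := Metric.mem_closure_iff.1 ha (ε / 2) (by positivity)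
    have h1 := hσ a ha i
    have h2 := hσ b hb i
    have h3 := dist_triangle_right (σ a) (σ b) (x i)
    have h4 := dist_triangle_left b (y i) a
    linarith
  let τ : Y → X := fun a => if a ∈ C then σ a else x 0
  have hτC : ∀ a ∈ C, τ a = σ a := fun a ha => if_pos ha
  have hτy : ∀ i, τ (y i) = x i := by
    intro i
    rw [hτC _ (hyC i)]
    have := hσ _ (hyC i) i
    rw [dist_self] at this
    exact dist_le_zero.1 this
  have hτL : ∀ a ∈ C, ∀ b ∈ C, dist (τ a) (τ b) ≤ dist a b := by
    intro a ha b hb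
    rw [hτC a ha, hτC b hb]; exact hσL a ha b hb
  have hτcont : ContinuousOn τ C := by
    have : LipschitzOnWith 1 τ C := LipschitzOnWith.of_dist_le_mul (by simpa using hτL)
    exact this.continuousOn
  have hτm : Measurable τ := by
    refine measurable_of_isOpen fun V hV => ?_
    obtain ⟨W, hW, hWV⟩ := (_root_.continuousOn_iff'.1 hτcont) V hV
    have : τ ⁻¹' V = (W ∩ C) ∪ (Cᶜ ∩ {a | x 0 ∈ V}) := by
      rw [← hWV]
      ext a
      by_cases ha : a ∈ C <;> simp [ha, τ]
    rw [this]
    exact (hW.measurableSet.inter hCcl.measurableSet).union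
      (hCcl.measurableSet.compl.inter (.const _))
  have hprob : IsProbabilityMeasure (μY.map τ) := Measure.isProbabilityMeasure_map hτm.aemeasurable
  have hmap : μY.map τ = μX := by
    refine measure_eq_of_closed_le μX (μY.map τ) fun F hF => ?_
    have key : ∀ n : ℕ, (μY.map τ).real F ≤
        μX.real (Metric.cthickening (1 / ((n : ℝ) + 1)) F) := by
      intro n
      have hV : IsOpen (Metric.thickening (1 / ((n : ℝ) + 1)) F) := Metric.isOpen_thickening
      obtain ⟨W, hW, hWV⟩ := (_root_.continuousOn_iff'.1 hτcont) _ hV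
      have h1 : (μY.map τ).real F ≤ μY.real W := by
        rw [map_measureReal_apply hτm hF.measurableSet]
        refine ENNReal.toReal_mono (measure_ne_top _ _) ?_
        refine measure_mono_ae ?_
        have hCae : ∀ᵐ a ∂μY, a ∈ C := hC0
        filter_upwards [hCae] with a ha haF
        have : a ∈ W ∩ C := by
          rw [← hWV]
          exact ⟨Metric.self_subset_thickening (by positivity) F haF, ha⟩
        exact this.1
      refine h1.trans (good_compare hx hy Metric.isClosed_cthickening hW fun i hi => ?_)
      have : y i ∈ W ∩ C := ⟨hi, hyC i⟩
      rw [← hWV] at this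
      have h2 := this.1
      rw [Set.mem_preimage, hτy] at h2
      exact Metric.thickening_subset_cthickening _ _ h2
    have h0 := (tendsto_measure_cthickening_of_isClosed (μ := μX) ⟨1, one_pos, measure_ne_top _ _⟩ hF)
    have hl := (ENNReal.tendsto_toReal (measure_ne_top μX F)).comp
      (h0.comp tendsto_one_div_add_atTop_nhds_zero_nat)
    exact ge_of_tendsto' hl key
  have hsupp : msupp μY ⊆ C := by
    intro a ha
    by_contra hac
    obtain ⟨ε, hε, hb⟩ := Metric.isOpen_iff.1 hCcl.isOpen_compl a hac
    exact (ha ε hε).ne' (measure_mono_null hb hC0)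
  refine ⟨τ, hτm, ?_, hmap, fun a ha b hb => hτL a (hsupp ha) b (hsupp hb)⟩
  intro a ha ε hε
  rw [← hmap, Measure.map_apply hτm Metric.isOpen_ball.measurableSet]
  refine (ha ε hε).trans_le (measure_mono_ae ?_)
  have hCae : ∀ᵐ a ∂μY, a ∈ C := hC0
  filter_upwards [hCae] with b hb hbb
  exact (hτL b hb a (hsupp ha)).trans_lt hbb

lemma ae_msupp {Y : Type*} [MeasurableSpace Y] [MetricSpace Y] [SecondCountableTopology Y]
    (μ : Measure Y) : ∀ᵐ a ∂μ, a ∈ msupp μ := by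
  have h : ∀ᵐ a ∂μ, a ∈ μ.support := Measure.support_mem_ae
  filter_upwards [h] with a ha ε hε
  exact (Measure.mem_support_iff_forall a).1 ha _ (Metric.ball_mem_nhds a hε)

lemma nuM_le_of_leMetric {X Y : Type*} [MeasurableSpace X] [MetricSpace X]
    [SecondCountableTopology X] [BorelSpace X] [MeasurableSpace Y] [MetricSpace Y]
    [SecondCountableTopology Y] [BorelSpace Y]
    (μX : Measure X) (μY : Measure Y)
    [IsProbabilityMeasure μX] [IsProbabilityMeasure μY] (h : LeMetric μX μY)
    (m : ℕ) (A : Set (DIdx m → ℝ)) (hA : MeasurableSet A)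
    (hup : ∀ a ∈ A, ∀ b, a ≤ b → b ∈ A) : nuM μX m A ≤ nuM μY m A := by
  obtain ⟨τ, hτm, -, hmap, hL⟩ := h
  have hpi : Measure.pi (fun _ : Fin m => μX) =
      (Measure.pi (fun _ : Fin m => μY)).map (fun y i => τ (y i)) := by
    have : IsProbabilityMeasure (μY.map τ) := by rw [hmap]; infer_instance
    have h2 := Measure.pi_map_pi (μ := fun _ : Fin m => μY) (f := fun _ => τ)
      (fun _ => hτm.aemeasurable)
    rw [h2, hmap]
  have hm2 : Measurable (fun (y : Fin m → Y) i => τ (y i)) := by fun_prop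
  rw [nuM, nuM, Measure.map_apply (measurable_distMatMap m) hA,
    Measure.map_apply (measurable_distMatMap m) hA, hpi,
    Measure.map_apply hm2 (measurable_distMatMap m hA)]
  refine measure_mono_ae ?_
  have hs : ∀ᵐ y ∂(Measure.pi (fun _ : Fin m => μY)), ∀ i, y i ∈ msupp μY := by
    rw [ae_all_iff]
    intro i
    exact (measurePreserving_eval (fun _ : Fin m => μY) i).quasiMeasurePreserving.ae (ae_msupp μY)
  filter_upwards [hs] with y hy hyA
  exact hup _ hyA _ fun p => hL _ (hy _) _ (hy _)

/-- `(X, r_X, μ_X) ≼_metric (Y, r_Y, μ_Y)` iff the order-`m` distance matrix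
measures are dominated on all increasing Borel sets, for every `m ≥ 2`. -/
theorem stmt1 {X Y : Type*} [MeasurableSpace X] [MetricSpace X] [SecondCountableTopology X] [CompleteSpace X] [BorelSpace X] [MeasurableSpace Y] [MetricSpace Y] [SecondCountableTopology Y] [CompleteSpace Y] [BorelSpace Y]
    (μX : Measure X) (μY : Measure Y)
    [IsProbabilityMeasure μX] [IsProbabilityMeasure μY] :
    LeMetric μX μY ↔
      ∀ m : ℕ, 2 ≤ m → ∀ A : Set (DIdx m → ℝ), MeasurableSet A →
        (∀ a ∈ A, ∀ b, a ≤ b → b ∈ A) → nuM μX m A ≤ nuM μY m A := by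
  constructor
  · intro h m _ A hA hup
    exact nuM_le_of_leMetric μX μY h m A hA hup
  · intro h
    obtain ⟨x, y, hx, hy, hxy⟩ := exists_pair μX μY h
    exact leMetric_of_pair μX μY hx hy hxy

end MMOrder
end

section
/- The relation ≼ on mm spaces is antisymmetric up to equivalence: if (X, r_X, μ_X) and (Y, r_Y, μ_Y) are mm spaces with (X, r_X, μ_X) ≼ (Y, r_Y, μ_Y) and (Y, r_Y, μ_Y) ≼ (X, r_X, μ_X), then (X, r_X, μ_X) and (Y, r_Y, μ_Y) are equivalent. -/
open MeasureTheory Metric Filter Topology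

namespace MMOrder

theorem aux_msupp_eq {X : Type*} [MeasurableSpace X] [MetricSpace X] (μ : Measure X) :
    msupp μ = μ.support := by
  ext x
  rw [Metric.nhds_basis_ball.mem_measureSupport]
  rfl

theorem aux_isom {X : Type*} [MeasurableSpace X] [MetricSpace X] [SecondCountableTopology X]
    [BorelSpace X] (μ : Measure X) [IsFiniteMeasure μ] (f : X → X)
    (hf : MeasurePreserving f μ μ) (hm : Set.MapsTo f (msupp μ) (msupp μ))
    (hl : ∀ x ∈ msupp μ, ∀ y ∈ msupp μ, dist (f x) (f y) ≤ dist x y)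
    (x : X) (hx : x ∈ msupp μ) (y : X) (hy : y ∈ msupp μ) :
    dist x y ≤ dist (f x) (f y) := by
  have hit : ∀ n : ℕ, ∀ a ∈ msupp μ, ∀ b ∈ msupp μ, dist (f^[n] a) (f^[n] b) ≤ dist a b := by
    intro n
    induction n with
    | zero => intro a _ b _; simp
    | succ n ih =>
      intro a ha b hb
      rw [Function.iterate_succ_apply, Function.iterate_succ_apply]
      exact (ih _ (hm ha) _ (hm hb)).trans (hl a ha b hb)
  have hSm : MeasurableSet (msupp μ) := by
    rw [aux_msupp_eq]; exact Measure.isClosed_support.measurableSet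
  have hS0 : μ (msupp μ)ᶜ = 0 := by
    rw [aux_msupp_eq]; exact Measure.measure_compl_support
  have hpos : ∀ z ∈ msupp μ, ∀ ε : ℝ, 0 < ε → μ (ball z ε ∩ msupp μ) ≠ 0 := by
    intro z hz ε hε
    rw [measure_inter_conull hS0]
    exact (hz ε hε).ne'
  refine le_of_forall_pos_le_add fun ε hε => ?_
  have h4 : 0 < ε / 4 := by linarith
  obtain ⟨⟨a, b⟩, hab, n, hn, hr⟩ := (hf.prod hf).conservative.exists_mem_iterate_mem
    (s := (ball x (ε / 4) ∩ msupp μ) ×ˢ (ball y (ε / 4) ∩ msupp μ))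
    ((measurableSet_ball.inter hSm).prod (measurableSet_ball.inter hSm)).nullMeasurableSet
    (by rw [Measure.prod_prod]; exact mul_ne_zero (hpos x hx _ h4) (hpos y hy _ h4))
  obtain ⟨n, rfl⟩ := Nat.exists_eq_succ_of_ne_zero hn
  rw [Prod.map_iterate] at hr
  obtain ⟨⟨ha, haS⟩, hb, hbS⟩ := hab
  obtain ⟨⟨hra, -⟩, hrb, -⟩ := hr
  simp only [Prod.map_fst, Prod.map_snd, Nat.succ_eq_add_one, Function.iterate_succ_apply,
    mem_ball] at ha hb hra hrb haS hbS
  have e1 := hit n _ (hm haS) _ (hm hbS)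
  have e2 := hl a haS x hx
  have e3 := hl b hbS y hy
  have t1 := dist_triangle4 x (f^[n] (f a)) (f^[n] (f b)) y
  have t2 := dist_triangle4 (f a) (f x) (f y) (f b)
  rw [dist_comm x (f^[n] (f a))] at t1
  rw [dist_comm (f y)] at t2
  linarith

/-- the relation `≼` on mm spaces is antisymmetric up to equivalence. -/
theorem stmt6 {X Y : Type*} [MeasurableSpace X] [MetricSpace X] [SecondCountableTopology X] [CompleteSpace X] [BorelSpace X] [MeasurableSpace Y] [MetricSpace Y] [SecondCountableTopology Y] [CompleteSpace Y] [BorelSpace Y]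
    (μX : Measure X) (μY : Measure Y)
    [IsFiniteMeasure μX] [IsFiniteMeasure μY]
    (h1 : LeGen μX μY) (h2 : LeGen μY μX) :
    MMEquiv μX μY := by
  obtain ⟨νY, hνY, τ, hτm, hτS, hτ, hτl⟩ := h1
  obtain ⟨νX, hνX, σ, hσm, hσS, hσ, hσl⟩ := h2
  have m1 : μX Set.univ = νY Set.univ := by
    rw [← hτ, Measure.map_apply hτm MeasurableSet.univ, Set.preimage_univ]
  have m2 : μY Set.univ = νX Set.univ := by
    rw [← hσ, Measure.map_apply hσm MeasurableSet.univ, Set.preimage_univ]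
  have l1 := hνY Set.univ
  have l2 := hνX Set.univ
  haveI : IsFiniteMeasure νY := ⟨l1.trans_lt (measure_lt_top _ _)⟩
  haveI : IsFiniteMeasure νX := ⟨l2.trans_lt (measure_lt_top _ _)⟩
  have eY : νY = μY := Measure.eq_of_le_of_measure_univ_eq hνY
    (le_antisymm l1 (by rw [m2, ← m1]; exact l2))
  have eX : νX = μX := Measure.eq_of_le_of_measure_univ_eq hνX
    (le_antisymm l2 (by rw [m1, ← m2]; exact l1))
  subst eY
  subst eX
  refine ⟨σ, hσm, hσ, fun x hx y hy => le_antisymm (hσl x hx y hy) ?_⟩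
  have := aux_isom νX (τ ∘ σ) ((⟨hτm, hτ⟩ : MeasurePreserving τ νY νX).comp ⟨hσm, hσ⟩)
    (hτS.comp hσS)
    (fun a ha b hb => (hτl _ (hσS ha) _ (hσS hb)).trans (hσl a ha b hb)) x hx y hy
  exact this.trans (hτl _ (hσS hx) _ (hσS hy))

end MMOrder
end
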